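/- Let s, t > 0 and let ξ : [0, s ∧ t] → [0, ∞) be a bounded measurable function. Then lim_{R → ∞} (1/R) · ∫_0^{s∧t} ξ(r) · ( ∫_{−R}^R ∫_{−R}^R p_{t+s−2r}(x−x′) dx dx′ ) dr = 2·∫_0^{s∧t} ξ(r) dr. (Note that t + s − 2r > 0 for almost every r ∈ [0, s ∧ t].) -/

import Mathlib

open MeasureTheory Filter

/-- The one-dimensional heat kernel `p_t(x) = (2πt)^{-1/2} exp(-x²/(2t))`. -/
noncomputable def heatKernel (t x : ℝ) : ℝ :=
  (Real.sqrt (2 * Real.pi * t))⁻¹ * Real.exp (-x ^ 2 / (2 * t))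

open ProbabilityTheory

lemma heatKernel_eq_gaussianPDFReal {τ : ℝ} (hτ : 0 ≤ τ) :
    heatKernel τ = gaussianPDFReal 0 ⟨τ, hτ⟩ := by
  ext x
  simp only [heatKernel, gaussianPDFReal, sub_zero]
  rfl

lemma heatKernel_nonneg (τ x : ℝ) : 0 ≤ heatKernel τ x := by
  unfold heatKernel
  positivity

lemma measurable_heatKernel : Measurable (fun p : ℝ × ℝ => heatKernel p.1 p.2) := by
  unfold heatKernel
  fun_prop

lemma integrable_heatKernel {τ : ℝ} (hτ : 0 < τ) : Integrable (heatKernel τ) := by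
  rw [heatKernel_eq_gaussianPDFReal hτ.le]
  exact integrable_gaussianPDFReal _ _

lemma integral_heatKernel {τ : ℝ} (hτ : 0 < τ) : ∫ x, heatKernel τ x = 1 := by
  rw [heatKernel_eq_gaussianPDFReal hτ.le]
  exact integral_gaussianPDFReal_eq_one _ fun h => hτ.ne' (congrArg NNReal.toReal h)

lemma setIntegral_heatKernel_sub_nonneg (τ y : ℝ) (S : Set ℝ) :
    0 ≤ ∫ x in S, heatKernel τ (x - y) :=
  integral_nonneg fun _ => heatKernel_nonneg _ _

lemma setIntegral_heatKernel_sub_le_one {τ : ℝ} (hτ : 0 < τ) (y : ℝ) (S : Set ℝ) :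
    ∫ x in S, heatKernel τ (x - y) ≤ 1 := by
  rw [← integral_heatKernel hτ, ← integral_sub_right_eq_self (heatKernel τ) y]
  exact setIntegral_le_integral ((integrable_heatKernel hτ).comp_sub_right y)
    (.of_forall fun _ => heatKernel_nonneg _ _)

lemma stronglyMeasurable_setIntegral_heatKernel_sub (S : Set ℝ) :
    StronglyMeasurable (fun p : ℝ × ℝ => ∫ x in S, heatKernel p.1 (x - p.2)) :=
  StronglyMeasurable.integral_prod_right'
    (f := fun q : (ℝ × ℝ) × ℝ => heatKernel q.1.1 (q.2 - q.1.2))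
    (measurable_heatKernel.comp (f := fun q : (ℝ × ℝ) × ℝ => (q.1.1, q.2 - q.1.2))
      (by fun_prop)).stronglyMeasurable

/-- Rescaling the outer variable turns the double integral into an average over `[-1, 1]`. -/
lemma inv_mul_setIntegral_heatKernel_sub {R : ℝ} (hR : 0 < R) (τ : ℝ) :
    R⁻¹ * (∫ y in Set.Icc (-R) R, ∫ x in Set.Icc (-R) R, heatKernel τ (x - y)) =
      ∫ u in Set.Ioo (-1 : ℝ) 1, ∫ x in Set.Icc (-R) R, heatKernel τ (x - R * u) := by
  rw [integral_Icc_eq_integral_Ioc, ← integral_Ioc_eq_integral_Ioo,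
    ← intervalIntegral.integral_of_le (by linarith), ← intervalIntegral.integral_of_le (by norm_num),
    intervalIntegral.integral_comp_mul_left
      (fun y => ∫ x in Set.Icc (-R) R, heatKernel τ (x - y)) hR.ne']
  simp

lemma tendsto_setIntegral_heatKernel_sub_mul {τ : ℝ} (hτ : 0 < τ) {u : ℝ}
    (hu : u ∈ Set.Ioo (-1 : ℝ) 1) :
    Tendsto (fun R : ℝ => ∫ x in Set.Icc (-R) R, heatKernel τ (x - R * u)) atTop (nhds 1) := by
  have hlim : Tendsto (fun R : ℝ => ∫ x in (R * (-1 - u))..(R * (1 - u)), heatKernel τ x)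
      atTop (nhds 1) := by
    have h := intervalIntegral_tendsto_integral (integrable_heatKernel hτ)
      (tendsto_id.atTop_mul_const_of_neg (by linarith [hu.1] : -1 - u < 0))
      (tendsto_id.atTop_mul_const (by linarith [hu.2] : 0 < 1 - u))
    rwa [integral_heatKernel hτ] at h
  refine hlim.congr' ?_
  filter_upwards [eventually_ge_atTop 0] with R hR
  rw [integral_Icc_eq_integral_Ioc, ← intervalIntegral.integral_of_le (by linarith),
    intervalIntegral.integral_comp_sub_right (heatKernel τ)]
  congr 1 <;> ring

lemma tendsto_inv_mul_setIntegral_heatKernel_sub {τ : ℝ} (hτ : 0 < τ) :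
    Tendsto (fun R : ℝ =>
        R⁻¹ * ∫ y in Set.Icc (-R) R, ∫ x in Set.Icc (-R) R, heatKernel τ (x - y))
      atTop (nhds 2) := by
  have hlim : Tendsto (fun R : ℝ => ∫ u in Set.Ioo (-1 : ℝ) 1,
      ∫ x in Set.Icc (-R) R, heatKernel τ (x - R * u)) atTop
      (nhds (∫ _ in Set.Ioo (-1 : ℝ) 1, (1 : ℝ))) := by
    refine tendsto_integral_filter_of_dominated_convergence (fun _ => 1)
      (.of_forall fun R => ?_) (.of_forall fun R => .of_forall fun u => ?_)
      (integrable_const _) ?_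
    · exact ((stronglyMeasurable_setIntegral_heatKernel_sub _).comp_measurable
        (g := fun u : ℝ => (τ, R * u)) (by fun_prop)).aestronglyMeasurable
    · rw [Real.norm_of_nonneg (setIntegral_heatKernel_sub_nonneg _ _ _)]
      exact setIntegral_heatKernel_sub_le_one hτ _ _
    · filter_upwards [ae_restrict_mem measurableSet_Ioo] with u hu
      exact tendsto_setIntegral_heatKernel_sub_mul hτ hu
  have hvol : ∫ _ in Set.Ioo (-1 : ℝ) 1, (1 : ℝ) = 2 := by
    simp [Measure.real]
    norm_num
  rw [hvol] at hlim
  refine hlim.congr' ?_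
  filter_upwards [eventually_gt_atTop 0] with R hR
  exact (inv_mul_setIntegral_heatKernel_sub hR τ).symm

lemma norm_inv_mul_setIntegral_heatKernel_sub_le {τ : ℝ} (hτ : 0 < τ) {R : ℝ} (hR : 0 < R) :
    ‖R⁻¹ * ∫ y in Set.Icc (-R) R, ∫ x in Set.Icc (-R) R, heatKernel τ (x - y)‖ ≤ 2 := by
  rw [inv_mul_setIntegral_heatKernel_sub hR]
  have h := norm_setIntegral_le_of_norm_le_const (μ := volume) (s := Set.Ioo (-1 : ℝ) 1)
    (f := fun u => ∫ x in Set.Icc (-R) R, heatKernel τ (x - R * u)) (C := 1) (by simp)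
    fun u _ => by
      rw [Real.norm_of_nonneg (setIntegral_heatKernel_sub_nonneg _ _ _)]
      exact setIntegral_heatKernel_sub_le_one hτ _ _
  refine h.trans_eq ?_
  simp [Measure.real]
  norm_num

/-- The deterministic core of Proposition 3.1: for `s, t > 0` and a bounded
nonnegative measurable function `ξ` on `[0, s ∧ t]`,
`lim_{R → ∞} (1/R) ∫_0^{s∧t} ξ(r) ( ∫_{-R}^R ∫_{-R}^R p_{t+s-2r}(x-x') dx dx' ) dr
  = 2 ∫_0^{s∧t} ξ(r) dr`. -/
theorem covariance_limit (s t : ℝ) (hs : 0 < s) (ht : 0 < t)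
    (ξ : ℝ → ℝ)
    (hmeas : AEMeasurable ξ (volume.restrict (Set.Icc (0 : ℝ) (min s t))))
    (hnonneg : ∀ r ∈ Set.Icc (0 : ℝ) (min s t), 0 ≤ ξ r)
    (hbdd : ∃ M : ℝ, ∀ r ∈ Set.Icc (0 : ℝ) (min s t), ξ r ≤ M) :
    Tendsto (fun R : ℝ =>
        (1 / R) * ∫ r in Set.Icc (0 : ℝ) (min s t), ξ r *
          (∫ x' in Set.Icc (-R) R, ∫ x in Set.Icc (-R) R, heatKernel (t + s - 2 * r) (x - x')))
      atTop (nhds (2 * ∫ r in Set.Icc (0 : ℝ) (min s t), ξ r)) := by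
  obtain ⟨M, hM⟩ := hbdd
  simp_rw [integral_Icc_eq_integral_Ico (x := (0 : ℝ)) (y := min s t)]
  rw [← integral_const_mul]
  simp_rw [← integral_const_mul (1 / (_ : ℝ))]
  have hτ : ∀ r ∈ Set.Ico (0 : ℝ) (min s t), 0 < t + s - 2 * r := fun r hr => by
    have := lt_min_iff.1 hr.2
    linarith
  have hξ := (hmeas.mono_measure
    (Measure.restrict_mono Set.Ico_subset_Icc_self le_rfl)).aestronglyMeasurable
  refine tendsto_integral_filter_of_dominated_convergence (fun _ => M * 2)
    (.of_forall fun R => ?_) ?_ (integrable_const _) ?_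
  · have hinner := StronglyMeasurable.integral_prod_right' (ν := volume.restrict (Set.Icc (-R) R))
      ((stronglyMeasurable_setIntegral_heatKernel_sub (Set.Icc (-R) R)).comp_measurable
        (g := fun q : ℝ × ℝ => (t + s - 2 * q.1, q.2)) (by fun_prop))
    exact (hξ.mul hinner.aestronglyMeasurable).const_mul _
  · filter_upwards [eventually_gt_atTop 0] with R hR
    filter_upwards [ae_restrict_mem measurableSet_Ico] with r hr
    have hr' := Set.Ico_subset_Icc_self hr
    rw [one_div, mul_left_comm, norm_mul, Real.norm_of_nonneg (hnonneg r hr')]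
    exact mul_le_mul (hM r hr') (norm_inv_mul_setIntegral_heatKernel_sub_le (hτ r hr) hR)
      (norm_nonneg _) ((hnonneg r hr').trans (hM r hr'))
  · filter_upwards [ae_restrict_mem measurableSet_Ico] with r hr
    have h := (tendsto_inv_mul_setIntegral_heatKernel_sub (hτ r hr)).const_mul (ξ r)
    rw [mul_comm 2 (ξ r)]
    refine h.congr fun R => ?_
    rw [one_div, mul_left_comm]
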